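/- arXiv:1404.0907 — 3 statements merged into one kernel-verified Lean document; each statement's English description precedes it below -/
import Mathlib

section
/- Let H₁ and H₂ be Hilbert spaces and let S ∈ L(H₁,H₂) and T ∈ L(H₂,H₁) be such that R(TS) and R(ST) are finite-dimensional subspaces of H₁ and H₂ respectively. Let H = H₁ ⊕ H₂ (orthogonal direct sum), let U ∈ L(H) be the block operator U = [[0, T],[S, 0]], and let V = U + U*. Then the following statements are equivalent: (i) (S,T) is a Fredholm pair; (ii) V is a Fredholm operator; (iii) V² is a Fredholm operator; (iv) UU* + U*U is a Fredholm operator; (v) TT* + S*S ∈ L(H₁) and SS* + T*T ∈ L(H₂) are Fredholm operators. -/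
open Module ContinuousLinearMap

noncomputable section

set_option maxHeartbeats 1000000
set_option synthInstance.maxHeartbeats 1000000

/-- For submodules `p q` of a space `E`, the quotient space `p / (p ⊓ q)`. -/
abbrev relQuot {E : Type*} [AddCommGroup E] [Module ℂ E] (p q : Submodule ℂ E) : Type _ :=
  ↥p ⧸ ((p ⊓ q).comap p.subtype)

section Defs

variable {H₁ H₂ : Type*} [NormedAddCommGroup H₁] [NormedSpace ℂ H₁]
  [NormedAddCommGroup H₂] [NormedSpace ℂ H₂]

/-- `(S, T)` is a Fredholm pair if the four quotients `N(S)/(N(S) ⊓ R(T))`,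
`R(T)/(N(S) ⊓ R(T))`, `N(T)/(N(T) ⊓ R(S))`, `R(S)/(N(T) ⊓ R(S))` are finite dimensional. -/
def IsFredholmPair (S : H₁ →L[ℂ] H₂) (T : H₂ →L[ℂ] H₁) : Prop :=
  FiniteDimensional ℂ (relQuot (LinearMap.ker S.toLinearMap) (LinearMap.range T.toLinearMap)) ∧
  FiniteDimensional ℂ (relQuot (LinearMap.range T.toLinearMap) (LinearMap.ker S.toLinearMap)) ∧
  FiniteDimensional ℂ (relQuot (LinearMap.ker T.toLinearMap) (LinearMap.range S.toLinearMap)) ∧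
  FiniteDimensional ℂ (relQuot (LinearMap.range S.toLinearMap) (LinearMap.ker T.toLinearMap))

/-- The index of a Fredholm pair:
`ind (S,T) = dim N(S)/(N(S)⊓R(T)) - dim R(T)/(N(S)⊓R(T)) - dim N(T)/(N(T)⊓R(S)) + dim R(S)/(N(T)⊓R(S))`. -/
def pairIndex (S : H₁ →L[ℂ] H₂) (T : H₂ →L[ℂ] H₁) : ℤ :=
  (finrank ℂ (relQuot (LinearMap.ker S.toLinearMap) (LinearMap.range T.toLinearMap)) : ℤ)
    - (finrank ℂ (relQuot (LinearMap.range T.toLinearMap) (LinearMap.ker S.toLinearMap)) : ℤ)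
    - (finrank ℂ (relQuot (LinearMap.ker T.toLinearMap) (LinearMap.range S.toLinearMap)) : ℤ)
    + (finrank ℂ (relQuot (LinearMap.range S.toLinearMap) (LinearMap.ker T.toLinearMap)) : ℤ)

/-- A bounded operator is Fredholm if its kernel is finite dimensional, its range is closed
and its cokernel is finite dimensional. -/
def IsFredholmOp (A : H₁ →L[ℂ] H₂) : Prop :=
  FiniteDimensional ℂ (LinearMap.ker A.toLinearMap) ∧ IsClosed (LinearMap.range A.toLinearMap : Set H₂) ∧
  FiniteDimensional ℂ (H₂ ⧸ LinearMap.range A.toLinearMap)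

/-- The index of a Fredholm operator: `ind A = dim N(A) - dim H₂/R(A)`. -/
def opIndex (A : H₁ →L[ℂ] H₂) : ℤ :=
  (finrank ℂ (LinearMap.ker A.toLinearMap) : ℤ) - (finrank ℂ (H₂ ⧸ LinearMap.range A.toLinearMap) : ℤ)

end Defs

variable {H₁ H₂ : Type*} [NormedAddCommGroup H₁] [InnerProductSpace ℂ H₁] [CompleteSpace H₁]
  [NormedAddCommGroup H₂] [InnerProductSpace ℂ H₂] [CompleteSpace H₂]

section FiniteCodimension

variable {E F : Type*} [AddCommGroup E] [Module ℂ E] [AddCommGroup F] [Module ℂ F]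

/-- The image of `p` in `E ⧸ q` is finite dimensional iff `p` is contained in `q` up to a
finite-dimensional subspace. -/
theorem finiteDimensional_map_mkQ_iff (p q : Submodule ℂ E) :
    FiniteDimensional ℂ (p.map q.mkQ) ↔
      ∃ G : Submodule ℂ E, FiniteDimensional ℂ G ∧ p ≤ q ⊔ G := by
  constructor
  · intro h
    obtain ⟨s, hs⟩ := q.mkQ.exists_rightInverse_of_surjective q.range_mkQ
    refine ⟨(p.map q.mkQ).map s, inferInstance, fun x hx => ?_⟩
    have hxs : x - s (q.mkQ x) ∈ q := by
      rw [← Submodule.Quotient.mk_eq_zero, Submodule.Quotient.mk_sub, sub_eq_zero]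
      exact (LinearMap.congr_fun hs (q.mkQ x)).symm
    exact Submodule.mem_sup.2 ⟨_, hxs, s (q.mkQ x),
      Submodule.mem_map_of_mem (Submodule.mem_map_of_mem hx), sub_add_cancel _ _⟩
  · rintro ⟨G, hG, hle⟩
    have : p.map q.mkQ ≤ G.map q.mkQ := by
      refine (Submodule.map_mono hle).trans ?_
      simp [Submodule.map_sup]
    exact Submodule.finiteDimensional_of_le this

theorem finiteDimensional_relQuot_iff (p q : Submodule ℂ E) :
    FiniteDimensional ℂ (relQuot p q) ↔
      ∃ G : Submodule ℂ E, FiniteDimensional ℂ G ∧ p ≤ q ⊔ G := by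
  rw [← finiteDimensional_map_mkQ_iff]
  have hker : (p ⊓ q).comap p.subtype = LinearMap.ker (q.mkQ ∘ₗ p.subtype) := by
    ext x; simp
  have hrange : LinearMap.range (q.mkQ ∘ₗ p.subtype) = p.map q.mkQ := by
    rw [LinearMap.range_comp, Submodule.range_subtype]
  have e := (Submodule.quotEquivOfEq _ _ hker).trans (q.mkQ ∘ₗ p.subtype).quotKerEquivRange
  rw [hrange] at e
  exact Module.Finite.equiv_iff e

theorem cofg_iff_exists_sup_eq_top (q : Submodule ℂ E) :
    q.CoFG ↔ ∃ G : Submodule ℂ E, FiniteDimensional ℂ G ∧ q ⊔ G = ⊤ := by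
  simp_rw [← top_le_iff]
  rw [← finiteDimensional_map_mkQ_iff, Submodule.map_top, Submodule.range_mkQ]
  exact (Module.Finite.equiv_iff Submodule.topEquiv).symm

theorem finiteDimensional_range_of_ker_le {G : Type*} [AddCommGroup G] [Module ℂ G]
    {f : E →ₗ[ℂ] F} {g : E →ₗ[ℂ] G} (hf : FiniteDimensional ℂ (LinearMap.range f))
    (h : LinearMap.ker f ≤ LinearMap.ker g) : FiniteDimensional ℂ (LinearMap.range g) :=
  Module.Finite.iff_fg.2 <| Submodule.range_fg_iff_ker_cofg.2 <|
    (Submodule.range_fg_iff_ker_cofg.1 (Module.Finite.iff_fg.1 hf)).of_le h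

/-- The range of `f` is contained in the kernel of `g` up to a finite-dimensional subspace
if `g ∘ f` has finite rank. -/
theorem exists_range_le_ker_sup {G : Type*} [AddCommGroup G] [Module ℂ G]
    {f : E →ₗ[ℂ] F} {g : F →ₗ[ℂ] G} (h : FiniteDimensional ℂ (LinearMap.range (g ∘ₗ f))) :
    ∃ K : Submodule ℂ F, FiniteDimensional ℂ K ∧ LinearMap.range f ≤ LinearMap.ker g ⊔ K := by
  rw [← finiteDimensional_map_mkQ_iff, ← LinearMap.range_comp]
  refine finiteDimensional_range_of_ker_le h fun x hx => ?_
  simpa using hx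

end FiniteCodimension

section Hilbert

variable {E F : Type*} [NormedAddCommGroup E] [InnerProductSpace ℂ E] [CompleteSpace E]
  [NormedAddCommGroup F] [InnerProductSpace ℂ F] [CompleteSpace F]

theorem isClosed_range_of_injective_of_isClosed_sup (A : E →L[ℂ] F)
    (hA : A.toLinearMap.ker = ⊥) (G : Submodule ℂ F) [FiniteDimensional ℂ G]
    (h : IsClosed ((A.toLinearMap.range ⊔ G : Submodule ℂ F) : Set F)) :
    IsClosed (A.toLinearMap.range : Set F) := by
  set K := A.toLinearMap.range ⊔ G
  have : CompleteSpace K := h.completeSpace_coe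
  have hAK : ∀ x, A x ∈ K := fun x => Submodule.mem_sup_left ⟨x, rfl⟩
  let B : E →L[ℂ] K := A.codRestrict K hAK
  have hB : B.toLinearMap.ker = ⊥ := by
    rw [LinearMap.ker_eq_bot] at hA ⊢
    intro x y hxy
    exact hA (congrArg Subtype.val hxy)
  have hcofg : B.toLinearMap.range.CoFG := by
    have hG : FiniteDimensional ℂ (G.comap K.subtype) :=
      Module.Finite.of_injective
        (K.subtype.restrict (p := G.comap K.subtype) (q := G) fun _ hx => hx)
        fun x y hxy => Subtype.ext (Subtype.ext (congrArg (fun z : G => (z : F)) hxy))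
    refine (cofg_iff_exists_sup_eq_top _).2 ⟨G.comap K.subtype, hG, ?_⟩
    rw [eq_top_iff]
    rintro ⟨x, hx⟩ -
    obtain ⟨_, ⟨y, rfl⟩, z, hz, rfl⟩ := Submodule.mem_sup.1 hx
    exact Submodule.mem_sup.2 ⟨B y, ⟨y, rfl⟩, ⟨z, Submodule.mem_sup_right hz⟩, hz, rfl⟩
  obtain ⟨C, hC⟩ := B.toLinearMap.range.exists_isCompl
  have : FiniteDimensional ℂ C := Module.Finite.iff_fg.2 (hcofg.fg_of_isCompl hC)
  have hclosed := B.closed_complemented_range_of_isCompl_of_ker_eq_bot C hC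
    C.closed_of_finiteDimensional hB
  have himage := h.isClosedEmbedding_subtypeVal.isClosedMap _ hclosed
  convert himage using 1
  ext x
  simp [B]

omit [CompleteSpace F] in
theorem map_starProjection_orthogonal_ker (A : E →L[ℂ] F) (x : E) :
    A (A.toLinearMap.kerᗮ.starProjection x) = A x := by
  have : A (A.toLinearMap.ker.starProjection x) = 0 :=
    (A.toLinearMap.ker.starProjection_apply_mem x : _)
  rw [Submodule.starProjection_orthogonal_val, map_sub, this, sub_zero]

omit [CompleteSpace F] in
theorem range_domRestrict_orthogonal_ker (A : E →L[ℂ] F) :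
    (A ∘L A.toLinearMap.kerᗮ.subtypeL).toLinearMap.range = A.toLinearMap.range := by
  refine le_antisymm (LinearMap.range_comp_le_range _ _) ?_
  rintro _ ⟨x, rfl⟩
  exact ⟨⟨_, A.toLinearMap.kerᗮ.starProjection_apply_mem x⟩,
    map_starProjection_orthogonal_ker A x⟩

omit [CompleteSpace E] [CompleteSpace F] in
theorem ker_domRestrict_orthogonal_ker (A : E →L[ℂ] F) :
    (A ∘L A.toLinearMap.kerᗮ.subtypeL).toLinearMap.ker = ⊥ := by
  rw [eq_bot_iff]
  rintro ⟨x, hx⟩ h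
  have hx' : x ∈ A.toLinearMap.ker := h
  exact Subtype.ext (Submodule.disjoint_def.1 A.toLinearMap.ker.orthogonal_disjoint x hx' hx)

theorem isClosed_range_of_isClosed_sup (A : E →L[ℂ] F) (G : Submodule ℂ F)
    [FiniteDimensional ℂ G]
    (h : IsClosed ((A.toLinearMap.range ⊔ G : Submodule ℂ F) : Set F)) :
    IsClosed (A.toLinearMap.range : Set F) := by
  rw [← range_domRestrict_orthogonal_ker] at h ⊢
  exact isClosed_range_of_injective_of_isClosed_sup _ (ker_domRestrict_orthogonal_ker A) G h

theorem range_adjoint_le_orthogonal_ker (A : E →L[ℂ] F) :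
    (adjoint A).toLinearMap.range ≤ A.toLinearMap.kerᗮ := by
  rw [A.orthogonal_ker]
  exact Submodule.le_topologicalClosure _

theorem orthogonal_ker_le_range_adjoint (A : E →L[ℂ] F)
    (h : IsClosed (A.toLinearMap.range : Set F)) :
    A.toLinearMap.kerᗮ ≤ (adjoint A).toLinearMap.range := by
  intro y hy
  set B := A ∘L A.toLinearMap.kerᗮ.subtypeL
  have hinj : Function.Injective B := LinearMap.ker_eq_bot.1 (ker_domRestrict_orthogonal_ker A)
  have hclosed : IsClosed (B.toLinearMap.range : Set F) := by
    rwa [range_domRestrict_orthogonal_ker]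
  have : CompleteSpace B.toLinearMap.range := hclosed.completeSpace_coe
  obtain ⟨L, hL⟩ : B.HasLeftInverse :=
    .of_injective_of_isClosed_range_of_closedComplement_range hinj hclosed
      ⟨B.toLinearMap.range.orthogonalProjectionOnto,
        Submodule.orthogonalProjectionOnto_mem_subspace_eq_self⟩
  refine ⟨adjoint L ⟨y, hy⟩, ?_⟩
  have hmem : adjoint A (adjoint L ⟨y, hy⟩) - y ∈ A.toLinearMap.kerᗮ :=
    sub_mem (range_adjoint_le_orthogonal_ker A ⟨_, rfl⟩) hy
  refine sub_eq_zero.1 (inner_self_eq_zero (𝕜 := ℂ).1 ?_)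
  set d : A.toLinearMap.kerᗮ := ⟨_, hmem⟩
  have h1 : inner ℂ (adjoint A (adjoint L ⟨y, hy⟩)) (d : E) = inner ℂ y (d : E) := by
    rw [adjoint_inner_left]
    change inner ℂ _ (B d) = _
    rw [adjoint_inner_left, hL d]
    rfl
  change inner ℂ (adjoint A (adjoint L ⟨y, hy⟩) - y) (d : E) = 0
  rw [inner_sub_left, h1, sub_self]

theorem finiteDimensional_range_adjoint {A : E →L[ℂ] F}
    (h : FiniteDimensional ℂ A.toLinearMap.range) :
    FiniteDimensional ℂ (adjoint A).toLinearMap.range := by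
  have hcofg : A.toLinearMap.ker.CoFG :=
    Submodule.range_fg_iff_ker_cofg.1 (Module.Finite.iff_fg.1 h)
  have : FiniteDimensional ℂ A.toLinearMap.kerᗮ :=
    Module.Finite.iff_fg.2 (hcofg.fg_of_disjoint A.toLinearMap.ker.orthogonal_disjoint.symm)
  exact Submodule.finiteDimensional_of_le (range_adjoint_le_orthogonal_ker A)

theorem isFredholmOp_iff_of_isSelfAdjoint {A : E →L[ℂ] E} (hA : IsSelfAdjoint A) :
    IsFredholmOp A ↔
      ∃ G : Submodule ℂ E, FiniteDimensional ℂ G ∧ A.toLinearMap.range ⊔ G = ⊤ := by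
  rw [← cofg_iff_exists_sup_eq_top]
  refine ⟨fun h => h.2.2, fun h => ⟨?_, ?_, h⟩⟩
  · have hker : A.toLinearMap.rangeᗮ = A.toLinearMap.ker := by
      rw [A.orthogonal_range, hA.adjoint_eq]
    exact Module.Finite.iff_fg.2
      (h.fg_of_disjoint (hker ▸ A.toLinearMap.range.orthogonal_disjoint.symm))
  · obtain ⟨G, hG, htop⟩ := (cofg_iff_exists_sup_eq_top _).1 h
    exact isClosed_range_of_isClosed_sup A G (by rw [htop]; exact isClosed_univ)

theorem isSelfAdjoint_add_adjoint (U : E →L[ℂ] E) : IsSelfAdjoint (U + adjoint U) :=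
  IsSelfAdjoint.add_star_self U

theorem isSelfAdjoint_comp_adjoint_add (A : F →L[ℂ] E) (B : E →L[ℂ] F) :
    IsSelfAdjoint ((A ∘L adjoint A) + (adjoint B ∘L B)) := by
  rw [isSelfAdjoint_iff', map_add, adjoint_comp, adjoint_comp, adjoint_adjoint, adjoint_adjoint]

variable {U : E →L[ℂ] E}

theorem isFredholmOp_add_adjoint_of_ker_le
    (hU : FiniteDimensional ℂ (U ∘L U).toLinearMap.range)
    (h : ∃ G : Submodule ℂ E, FiniteDimensional ℂ G ∧
      U.toLinearMap.ker ≤ U.toLinearMap.range ⊔ G) :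
    IsFredholmOp (U + adjoint U) := by
  obtain ⟨G, hG, hker⟩ := h
  obtain ⟨K, hK, hrange⟩ := exists_range_le_ker_sup (f := U.toLinearMap) (g := U.toLinearMap) hU
  have hclosed : IsClosed (U.toLinearMap.range : Set E) := by
    refine isClosed_range_of_isClosed_sup U (G ⊔ K) ?_
    have heq : U.toLinearMap.range ⊔ (G ⊔ K) = U.toLinearMap.ker ⊔ (G ⊔ K) := by
      refine le_antisymm (sup_le (hrange.trans ?_) le_sup_right)
        (sup_le (hker.trans ?_) le_sup_right)
      · exact sup_le_sup_left le_sup_right _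
      · exact sup_le_sup_left le_sup_left _
    rw [heq]
    exact Submodule.isClosed_sup_finiteDimensional _ _ U.isClosed_ker
  set P := U.toLinearMap.ker.starProjection with hP
  set Q := U.toLinearMap.kerᗮ.starProjection with hQ
  have hPQ : ∀ x, P x = x - Q x := fun x => by
    rw [hP, hQ, Submodule.starProjection_orthogonal_val, sub_sub_cancel]
  have hUQ : ∀ x, U (Q x) = U x := map_starProjection_orthogonal_ker U
  have hUP : ∀ x, U (P x) = 0 := fun x => U.toLinearMap.ker.starProjection_apply_mem x
  have hQU : FiniteDimensional ℂ (adjoint (Q ∘L U)).toLinearMap.range := by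
    refine finiteDimensional_range_adjoint (finiteDimensional_range_of_ker_le hU fun x hx => ?_)
    have hx' : U x ∈ U.toLinearMap.ker := hx
    change Q (U x) = 0
    rw [hQ, Submodule.starProjection_orthogonal_val,
      Submodule.starProjection_eq_self_iff.2 hx', sub_self]
  have hUQ' : ∀ x, adjoint (Q ∘L U) x = adjoint U (Q x) := fun x => by
    rw [adjoint_comp, isSelfAdjoint_starProjection _ |>.adjoint_eq]
    rfl
  rw [isFredholmOp_iff_of_isSelfAdjoint (isSelfAdjoint_add_adjoint U)]
  set R := (U + adjoint U).toLinearMap.range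
  set D := (adjoint (Q ∘L U)).toLinearMap.range
  have hR1 : U.toLinearMap.range ≤ R ⊔ D := by
    rintro _ ⟨x, rfl⟩
    have : U x = (U + adjoint U) (Q x) - adjoint (Q ∘L U) x := by
      rw [hUQ', add_apply, hUQ, add_sub_cancel_right]
    exact this ▸ sub_mem (Submodule.mem_sup_left ⟨_, rfl⟩) (Submodule.mem_sup_right ⟨_, rfl⟩)
  have hR2 : (adjoint U).toLinearMap.range ≤ R ⊔ D := by
    rintro _ ⟨x, rfl⟩
    have : adjoint U x = (U + adjoint U) (P x) + adjoint (Q ∘L U) x := by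
      rw [hUQ', add_apply, hUP, zero_add, hPQ, map_sub, sub_add_cancel]
    exact this ▸ add_mem (Submodule.mem_sup_left ⟨_, rfl⟩) (Submodule.mem_sup_right ⟨_, rfl⟩)
  refine ⟨D ⊔ G, inferInstance, ?_⟩
  rw [eq_top_iff, ← Submodule.sup_orthogonal_of_hasOrthogonalProjection (K := U.toLinearMap.ker),
    ← sup_assoc]
  exact sup_le (hker.trans (sup_le_sup_right hR1 _))
    (((orthogonal_ker_le_range_adjoint U hclosed).trans hR2).trans le_sup_left)

theorem isFredholmOp_sq_of_isSelfAdjoint {A : E →L[ℂ] E} (hA : IsSelfAdjoint A)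
    (h : IsFredholmOp A) : IsFredholmOp (A ∘L A) := by
  have hAA : IsSelfAdjoint (A ∘L A) := by
    rw [isSelfAdjoint_iff', adjoint_comp, hA.adjoint_eq]
  rw [isFredholmOp_iff_of_isSelfAdjoint hA] at h
  rw [isFredholmOp_iff_of_isSelfAdjoint hAA]
  obtain ⟨G, hG, htop⟩ := h
  refine ⟨G.map A.toLinearMap ⊔ G, inferInstance, ?_⟩
  have : (A ∘L A).toLinearMap.range ⊔ G.map A.toLinearMap = A.toLinearMap.range := by
    rw [toLinearMap_comp, LinearMap.range_comp, ← Submodule.map_sup, htop, Submodule.map_top]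
  rw [← sup_assoc, this, htop]

theorem isFredholmOp_comp_adjoint_add_of_sq
    (hU : FiniteDimensional ℂ (U ∘L U).toLinearMap.range)
    (h : IsFredholmOp ((U + adjoint U) ∘L (U + adjoint U))) :
    IsFredholmOp ((U ∘L adjoint U) + (adjoint U ∘L U)) := by
  rw [isFredholmOp_iff_of_isSelfAdjoint (isSelfAdjoint_comp_adjoint_add U U)]
  obtain ⟨G, hG, htop⟩ := (cofg_iff_exists_sup_eq_top _).1 h.2.2
  have hU' := finiteDimensional_range_adjoint hU
  refine ⟨(U ∘L U).toLinearMap.range ⊔ (adjoint (U ∘L U)).toLinearMap.range ⊔ G,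
    inferInstance, ?_⟩
  rw [eq_top_iff, ← htop, ← sup_assoc]
  refine sup_le_sup_right ?_ _
  rintro _ ⟨x, rfl⟩
  have : ((U + adjoint U) ∘L (U + adjoint U)) x =
      ((U ∘L adjoint U) + (adjoint U ∘L U)) x + ((U ∘L U) x + adjoint (U ∘L U) x) := by
    simp only [adjoint_comp, comp_apply, add_apply, map_add]
    abel
  change ((U + adjoint U) ∘L (U + adjoint U)) x ∈ _
  rw [this]
  exact Submodule.add_mem_sup ⟨x, rfl⟩ (Submodule.add_mem_sup ⟨x, rfl⟩ ⟨x, rfl⟩)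

theorem exists_ker_le_range_sup_of_isFredholmOp
    (hU : FiniteDimensional ℂ (U ∘L U).toLinearMap.range)
    (h : IsFredholmOp ((U ∘L adjoint U) + (adjoint U ∘L U))) :
    ∃ G : Submodule ℂ E, FiniteDimensional ℂ G ∧
      U.toLinearMap.ker ≤ U.toLinearMap.range ⊔ G := by
  set W := (U ∘L adjoint U) + (adjoint U ∘L U) with hW
  obtain ⟨G, hG, htop⟩ := (cofg_iff_exists_sup_eq_top _).1 h.2.2
  have hker : FiniteDimensional ℂ W.toLinearMap.ker := h.1
  -- `W` commutes with `U` up to operators of finite rank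
  set D := (U ∘L U).toLinearMap.range ⊔
    ((U ∘L U).toLinearMap.range.map (adjoint U).toLinearMap ⊔ G.map U.toLinearMap)
  have hcomap : FiniteDimensional ℂ (D.comap W.toLinearMap) :=
    Module.Finite.iff_fg.2 <| Submodule.fg_of_fg_map_of_fg_inf_ker W.toLinearMap
      (Module.Finite.iff_fg.1 (Submodule.finiteDimensional_of_le (Submodule.map_comap_le _ D)))
      (Module.Finite.iff_fg.1 (Submodule.finiteDimensional_of_le inf_le_right))
  refine ⟨(D.comap W.toLinearMap).map (adjoint U).toLinearMap ⊔ G, inferInstance, fun x hx => ?_⟩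
  have hx' : U x = 0 := hx
  obtain ⟨_, ⟨y, rfl⟩, g, hg, hyg⟩ := Submodule.mem_sup.1 (htop ▸ Submodule.mem_top : x ∈ _)
  have hyg' : W y + g = x := hyg
  have hUy : W (U y) = adjoint U (U (U y)) - U (U (adjoint U y)) - U g := by
    have h0 : U (W y) + U g = 0 := by rw [← map_add, hyg', hx']
    rw [eq_neg_of_add_eq_zero_right h0]
    simp only [hW, add_apply, comp_apply, map_add]
    abel
  have hmem : U y ∈ D.comap W.toLinearMap := by
    change W (U y) ∈ D
    rw [hUy]
    refine sub_mem (sub_mem ?_ ?_) ?_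
    · exact Submodule.mem_sup_right (Submodule.mem_sup_left ⟨_, ⟨y, rfl⟩, rfl⟩)
    · exact Submodule.mem_sup_left ⟨adjoint U y, rfl⟩
    · exact Submodule.mem_sup_right (Submodule.mem_sup_right ⟨g, hg, rfl⟩)
  rw [← hyg', hW, add_apply, add_assoc]
  exact Submodule.add_mem_sup ⟨_, rfl⟩ (Submodule.add_mem_sup ⟨_, hmem, rfl⟩ hg)

end Hilbert

section Prod

variable {L M N : Type*} [AddCommGroup L] [Module ℂ L] [AddCommGroup M] [Module ℂ M]
  [AddCommGroup N] [Module ℂ N]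

theorem exists_comap_prod_le_sup_iff (e : L ≃ₗ[ℂ] M × N) (p₁ q₁ : Submodule ℂ M)
    (p₂ q₂ : Submodule ℂ N) :
    (∃ G : Submodule ℂ L, FiniteDimensional ℂ G ∧
        (p₁.prod p₂).comap e.toLinearMap ≤ (q₁.prod q₂).comap e.toLinearMap ⊔ G) ↔
      (∃ G : Submodule ℂ M, FiniteDimensional ℂ G ∧ p₁ ≤ q₁ ⊔ G) ∧
        ∃ G : Submodule ℂ N, FiniteDimensional ℂ G ∧ p₂ ≤ q₂ ⊔ G := by
  constructor
  · rintro ⟨G, hG, hle⟩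
    refine ⟨⟨G.map (LinearMap.fst ℂ M N ∘ₗ e.toLinearMap), inferInstance, fun x hx => ?_⟩,
      ⟨G.map (LinearMap.snd ℂ M N ∘ₗ e.toLinearMap), inferInstance, fun x hx => ?_⟩⟩
    · obtain ⟨y, hy, g, hg, hyg⟩ := Submodule.mem_sup.1 (@hle (e.symm (x, 0)) (by simp [hx]))
      refine Submodule.mem_sup.2 ⟨(e y).1, hy.1, (e g).1, ⟨g, hg, rfl⟩, ?_⟩
      rw [← Prod.fst_add, ← map_add, hyg, e.apply_symm_apply]
    · obtain ⟨y, hy, g, hg, hyg⟩ := Submodule.mem_sup.1 (@hle (e.symm (0, x)) (by simp [hx]))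
      refine Submodule.mem_sup.2 ⟨(e y).2, hy.2, (e g).2, ⟨g, hg, rfl⟩, ?_⟩
      rw [← Prod.snd_add, ← map_add, hyg, e.apply_symm_apply]
  · rintro ⟨⟨G₁, hG₁, h₁⟩, ⟨G₂, hG₂, h₂⟩⟩
    refine ⟨G₁.map (e.symm.toLinearMap ∘ₗ LinearMap.inl ℂ M N) ⊔
      G₂.map (e.symm.toLinearMap ∘ₗ LinearMap.inr ℂ M N), inferInstance, fun z hz => ?_⟩
    obtain ⟨y₁, hy₁, g₁, hg₁, h1⟩ := Submodule.mem_sup.1 (h₁ hz.1)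
    obtain ⟨y₂, hy₂, g₂, hg₂, h2⟩ := Submodule.mem_sup.1 (h₂ hz.2)
    have hz' : z = e.symm (y₁, y₂) + (e.symm (g₁, 0) + e.symm (0, g₂)) := by
      rw [← map_add, ← map_add, e.eq_symm_apply]
      exact Prod.ext (by simpa using h1.symm) (by simpa using h2.symm)
    rw [hz']
    refine Submodule.add_mem_sup ?_ (Submodule.add_mem_sup ⟨g₁, hg₁, rfl⟩ ⟨g₂, hg₂, rfl⟩)
    simp [hy₁, hy₂]

theorem ker_eq_comap_prod {M' N' L' : Type*} [AddCommGroup L'] [Module ℂ L'] [AddCommGroup M']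
    [Module ℂ M'] [AddCommGroup N'] [Module ℂ N'] (e : L ≃ₗ[ℂ] M × N) (e' : L' ≃ₗ[ℂ] M' × N')
    {f : L →ₗ[ℂ] L'} {a : M →ₗ[ℂ] M'} {b : N →ₗ[ℂ] N'}
    (hf : ∀ z, e' (f z) = (a (e z).1, b (e z).2)) :
    f.ker = (a.ker.prod b.ker).comap e.toLinearMap := by
  ext z
  rw [LinearMap.mem_ker, ← e'.map_eq_zero_iff, hf]
  simp [Prod.ext_iff]

theorem range_eq_comap_prod {M' N' L' : Type*} [AddCommGroup L'] [Module ℂ L'] [AddCommGroup M']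
    [Module ℂ M'] [AddCommGroup N'] [Module ℂ N'] (e : L ≃ₗ[ℂ] M × N) (e' : L' ≃ₗ[ℂ] M' × N')
    {f : L →ₗ[ℂ] L'} {a : M →ₗ[ℂ] M'} {b : N →ₗ[ℂ] N'}
    (hf : ∀ z, e' (f z) = (a (e z).1, b (e z).2)) :
    f.range = (a.range.prod b.range).comap e'.toLinearMap := by
  ext z
  constructor
  · rintro ⟨y, rfl⟩
    exact ⟨⟨(e y).1, by simp [hf]⟩, ⟨(e y).2, by simp [hf]⟩⟩
  · rintro ⟨⟨x, hx⟩, ⟨y, hy⟩⟩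
    refine ⟨e.symm (x, y), e'.injective ?_⟩
    rw [hf, e.apply_symm_apply]
    exact Prod.ext hx hy

theorem finiteDimensional_comap_prod (e : L ≃ₗ[ℂ] M × N) (p : Submodule ℂ M) (q : Submodule ℂ N)
    [FiniteDimensional ℂ p] [FiniteDimensional ℂ q] :
    FiniteDimensional ℂ ((p.prod q).comap e.toLinearMap) := by
  rw [Submodule.comap_equiv_eq_map_symm]
  have : FiniteDimensional ℂ (p.prod q) :=
    Module.Finite.iff_fg.2 (.prod (Module.Finite.iff_fg.1 ‹_›) (Module.Finite.iff_fg.1 ‹_›))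
  infer_instance

end Prod

omit [CompleteSpace H₁] [CompleteSpace H₂] in
theorem isFredholmPair_iff {S : H₁ →L[ℂ] H₂} {T : H₂ →L[ℂ] H₁}
    (hTS : FiniteDimensional ℂ (T ∘L S).toLinearMap.range)
    (hST : FiniteDimensional ℂ (S ∘L T).toLinearMap.range) :
    IsFredholmPair S T ↔
      (∃ G : Submodule ℂ H₁, FiniteDimensional ℂ G ∧
        S.toLinearMap.ker ≤ T.toLinearMap.range ⊔ G) ∧
      ∃ G : Submodule ℂ H₂, FiniteDimensional ℂ G ∧
        T.toLinearMap.ker ≤ S.toLinearMap.range ⊔ G := by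
  simp only [IsFredholmPair, finiteDimensional_relQuot_iff]
  exact ⟨fun h => ⟨h.1, h.2.2.1⟩,
    fun h => ⟨h.1, exists_range_le_ker_sup hST, h.2, exists_range_le_ker_sup hTS⟩⟩

theorem adjoint_apply_of_block {S : H₁ →L[ℂ] H₂} {T : H₂ →L[ℂ] H₁}
    {U : WithLp 2 (H₁ × H₂) →L[ℂ] WithLp 2 (H₁ × H₂)}
    (hU : ∀ z, WithLp.ofLp (U z) = (T (WithLp.ofLp z).2, S (WithLp.ofLp z).1))
    (z : WithLp 2 (H₁ × H₂)) :
    WithLp.ofLp (adjoint U z) =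
      (adjoint S (WithLp.ofLp z).2, adjoint T (WithLp.ofLp z).1) := by
  have h : adjoint U z = WithLp.toLp 2 (adjoint S (WithLp.ofLp z).2,
      adjoint T (WithLp.ofLp z).1) := by
    refine ext_inner_right ℂ fun w => ?_
    rw [adjoint_inner_left, WithLp.prod_inner_apply, WithLp.prod_inner_apply, hU]
    simp only [adjoint_inner_left]
    exact add_comm _ _
  rw [h]

theorem fredholm_pair_tfae (S : H₁ →L[ℂ] H₂) (T : H₂ →L[ℂ] H₁)
    (hTS : FiniteDimensional ℂ (LinearMap.range (T ∘L S).toLinearMap))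
    (hST : FiniteDimensional ℂ (LinearMap.range (S ∘L T).toLinearMap))
    (U : WithLp 2 (H₁ × H₂) →L[ℂ] WithLp 2 (H₁ × H₂))
    (hU : ∀ z : WithLp 2 (H₁ × H₂),
      WithLp.equiv 2 (H₁ × H₂) (U z) =
        (T (WithLp.equiv 2 (H₁ × H₂) z).2, S (WithLp.equiv 2 (H₁ × H₂) z).1)) :
    [IsFredholmPair S T,
     IsFredholmOp (U + adjoint U),
     IsFredholmOp ((U + adjoint U) ∘L (U + adjoint U)),
     IsFredholmOp ((U ∘L adjoint U) + (adjoint U ∘L U)),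
     IsFredholmOp ((T ∘L adjoint T) + (adjoint S ∘L S)) ∧
       IsFredholmOp ((S ∘L adjoint S) + (adjoint T ∘L T))].TFAE := by
  let e := WithLp.linearEquiv 2 ℂ (H₁ × H₂)
  let e' := e.trans (LinearEquiv.prodComm ℂ H₁ H₂)
  have hU₀ : ∀ z, WithLp.ofLp (U z) = (T (WithLp.ofLp z).2, S (WithLp.ofLp z).1) := hU
  have hU' := adjoint_apply_of_block hU₀
  have hswap : ∀ z, e' (U z) = (S (e z).1, T (e z).2) := fun z => congrArg Prod.swap (hU z)
  have hUU : FiniteDimensional ℂ (U ∘L U).toLinearMap.range := by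
    have hsq : ∀ z, e ((U ∘L U) z) = ((T ∘L S) (e z).1, (S ∘L T) (e z).2) := fun z => by
      change WithLp.ofLp (U (U z)) = _
      rw [hU₀, hU₀]
      rfl
    rw [range_eq_comap_prod e e (f := (U ∘L U).toLinearMap) (a := (T ∘L S).toLinearMap)
      (b := (S ∘L T).toLinearMap) hsq]
    exact finiteDimensional_comap_prod e _ _
  have hW : ∀ z, e (((U ∘L adjoint U) + (adjoint U ∘L U)) z) =
      (((T ∘L adjoint T) + (adjoint S ∘L S)) (e z).1,
        ((S ∘L adjoint S) + (adjoint T ∘L T)) (e z).2) := fun z => by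
    change WithLp.ofLp (U (adjoint U z)) + WithLp.ofLp (adjoint U (U z)) = _
    rw [hU₀, hU', hU', hU₀]
    rfl
  have hpair : IsFredholmPair S T ↔ ∃ G : Submodule ℂ (WithLp 2 (H₁ × H₂)),
      FiniteDimensional ℂ G ∧ U.toLinearMap.ker ≤ U.toLinearMap.range ⊔ G := by
    rw [isFredholmPair_iff hTS hST, ← exists_comap_prod_le_sup_iff e,
      ← ker_eq_comap_prod e e' (f := U.toLinearMap) hswap,
      ← range_eq_comap_prod e' e (f := U.toLinearMap) hU]
  tfae_have 1 → 2 := fun h => isFredholmOp_add_adjoint_of_ker_le hUU (hpair.1 h)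
  tfae_have 2 → 3 := isFredholmOp_sq_of_isSelfAdjoint (isSelfAdjoint_add_adjoint U)
  tfae_have 3 → 4 := isFredholmOp_comp_adjoint_add_of_sq hUU
  tfae_have 4 → 1 := fun h => hpair.2 (exists_ker_le_range_sup_of_isFredholmOp hUU h)
  tfae_have 4 ↔ 5 := by
    rw [isFredholmOp_iff_of_isSelfAdjoint (isSelfAdjoint_comp_adjoint_add U U),
      isFredholmOp_iff_of_isSelfAdjoint (isSelfAdjoint_comp_adjoint_add T S),
      isFredholmOp_iff_of_isSelfAdjoint (isSelfAdjoint_comp_adjoint_add S T)]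
    simp_rw [← top_le_iff]
    rw [← exists_comap_prod_le_sup_iff e, ← range_eq_comap_prod e e (f := ContinuousLinearMap.toLinearMap _) hW,
      Submodule.prod_top, Submodule.comap_top]
  tfae_finish
end
end

section
/- Let H₁ and H₂ be Hilbert spaces and let S ∈ L(H₁,H₂) and T ∈ L(H₂,H₁) be operators such that TS = 0 and ST = 0. Then the following statements are equivalent: (i) the quotients N(S)/R(T) and N(T)/R(S) are finite-dimensional; (ii) S + T* ∈ L(H₁,H₂) is a Fredholm operator; (iii) T + S* ∈ L(H₂,H₁) is a Fredholm operator. Furthermore, in this case (S,T) is a Fredholm pair and ind(S,T) = ind(S + T*) = − ind(T + S*). -/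
open Module ContinuousLinearMap

noncomputable section

set_option maxHeartbeats 1000000
set_option synthInstance.maxHeartbeats 1000000

/-- If `p ⊓ r = p ⊓ q`, then the inclusion of `p` induces an injection `p / (p ⊓ r) → E / q`. -/
theorem exists_relQuot_injection {E : Type*} [AddCommGroup E] [Module ℂ E] {p q r : Submodule ℂ E}
    (h : p ⊓ r = p ⊓ q) :
    ∃ f : relQuot p r →ₗ[ℂ] E ⧸ q, Function.Injective f ∧
      ∀ x : p, f (Submodule.Quotient.mk x) = Submodule.Quotient.mk (x : E) := by
  have hker : LinearMap.ker (q.mkQ ∘ₗ p.subtype) = (p ⊓ r).comap p.subtype := by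
    rw [h, LinearMap.ker_comp, Submodule.ker_mkQ, Submodule.comap_inf,
      Submodule.comap_subtype_self, top_inf_eq]
  refine ⟨Submodule.liftQ _ (q.mkQ ∘ₗ p.subtype) hker.ge, ?_, fun x => rfl⟩
  rw [← LinearMap.ker_eq_bot]
  exact Submodule.ker_liftQ_eq_bot' _ _ hker.symm

theorem nonempty_relQuot_equiv_quotient {E : Type*} [AddCommGroup E] [Module ℂ E]
    {p q r : Submodule ℂ E} (h : p ⊓ r = p ⊓ q) (htop : p ⊔ q = ⊤) :
    Nonempty (relQuot p r ≃ₗ[ℂ] E ⧸ q) := by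
  obtain ⟨f, hf, hfx⟩ := exists_relQuot_injection h
  refine ⟨LinearEquiv.ofBijective f ⟨hf, fun z => ?_⟩⟩
  obtain ⟨z, rfl⟩ := Submodule.Quotient.mk_surjective _ z
  obtain ⟨y, hy, w, hw, rfl⟩ := Submodule.mem_sup.1 (htop ▸ Submodule.mem_top : z ∈ p ⊔ q)
  refine ⟨Submodule.Quotient.mk ⟨y, hy⟩, ?_⟩
  rw [hfx, Submodule.Quotient.eq]
  simpa using hw

theorem nonempty_relQuot_equiv_of_sup_eq {E : Type*} [AddCommGroup E] [Module ℂ E]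
    {p q k : Submodule ℂ E} (hsup : q ⊔ k = p) (hinf : Disjoint q k) :
    Nonempty (relQuot p q ≃ₗ[ℂ] k) := by
  have hq : q ≤ p := hsup ▸ le_sup_left
  have hk : k ≤ p := hsup ▸ le_sup_right
  have hcompl : IsCompl ((p ⊓ q).comap p.subtype) (k.comap p.subtype) := by
    rw [inf_eq_right.2 hq]
    refine ⟨?_, ?_⟩
    · rw [disjoint_iff, ← Submodule.comap_inf, hinf.eq_bot, Submodule.comap_bot,
        Submodule.ker_subtype]
    · rw [codisjoint_iff, eq_top_iff]
      rintro ⟨x, hx⟩ -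
      obtain ⟨y, hy, w, hw, rfl⟩ := Submodule.mem_sup.1 (hsup ▸ hx)
      exact Submodule.mem_sup.2 ⟨⟨y, hq hy⟩, hy, ⟨w, hk hw⟩, hw, rfl⟩
  exact ⟨(Submodule.quotientEquivOfIsCompl _ _ hcompl).trans (Submodule.comapSubtypeEquivOfLe hk)⟩

theorem finite_relQuot_of_le {E : Type*} [AddCommGroup E] [Module ℂ E] {p q : Submodule ℂ E}
    (h : p ≤ q) : FiniteDimensional ℂ (relQuot p q) ∧ finrank ℂ (relQuot p q) = 0 := by
  have htop : (p ⊓ q).comap p.subtype = ⊤ := by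
    rw [inf_eq_left.2 h, Submodule.comap_subtype_self]
  have : Subsingleton (relQuot p q) := Submodule.Quotient.subsingleton_iff.2 htop
  exact ⟨inferInstance, finrank_zero_of_subsingleton⟩

theorem range_le_ker_of_comp_eq_zero {H K : Type*} [NormedAddCommGroup H] [NormedSpace ℂ H]
    [NormedAddCommGroup K] [NormedSpace ℂ K] {S : H →L[ℂ] K} {T : K →L[ℂ] H}
    (hST : S ∘L T = 0) :
    LinearMap.range T.toLinearMap ≤ LinearMap.ker S.toLinearMap := by
  rintro _ ⟨z, rfl⟩
  exact DFunLike.congr_fun hST z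

theorem pairIndex_swap {H K : Type*} [NormedAddCommGroup H] [NormedSpace ℂ H]
    [NormedAddCommGroup K] [NormedSpace ℂ K]
    (S : H →L[ℂ] K) (T : K →L[ℂ] H) : pairIndex T S = -pairIndex S T := by
  unfold pairIndex
  ring

theorem isFredholmPair_of_finiteDimensional {H K : Type*} [NormedAddCommGroup H]
    [NormedSpace ℂ H] [NormedAddCommGroup K] [NormedSpace ℂ K] {S : H →L[ℂ] K} {T : K →L[ℂ] H}
    (hTS : T ∘L S = 0) (hST : S ∘L T = 0)
    (h₁ : FiniteDimensional ℂ
      (relQuot (LinearMap.ker S.toLinearMap) (LinearMap.range T.toLinearMap)))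
    (h₂ : FiniteDimensional ℂ
      (relQuot (LinearMap.ker T.toLinearMap) (LinearMap.range S.toLinearMap))) :
    IsFredholmPair S T :=
  ⟨h₁, (finite_relQuot_of_le (range_le_ker_of_comp_eq_zero hST)).1, h₂,
    (finite_relQuot_of_le (range_le_ker_of_comp_eq_zero hTS)).1⟩

section HilbertSpace

variable {H K : Type*} [NormedAddCommGroup H] [InnerProductSpace ℂ H] [CompleteSpace H]

/-- On a Hilbert space, a bounded operator whose range has finite codimension has closed range. -/
theorem isClosed_range_of_finiteDimensional_quotient [NormedAddCommGroup K] [NormedSpace ℂ K]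
    [CompleteSpace K] (A : H →L[ℂ] K)
    [FiniteDimensional ℂ (K ⧸ LinearMap.range A.toLinearMap)] :
    IsClosed (LinearMap.range A.toLinearMap : Set K) := by
  set N := LinearMap.ker A.toLinearMap
  have : CompleteSpace N := A.isClosed_ker.completeSpace_coe
  let B : Nᗮ →L[ℂ] K := A ∘L Nᗮ.subtypeL
  have hrange : LinearMap.range B.toLinearMap = LinearMap.range A.toLinearMap := by
    refine le_antisymm ?_ ?_
    · rintro _ ⟨x, rfl⟩
      exact ⟨x, rfl⟩
    · rintro _ ⟨x, rfl⟩
      obtain ⟨y, hy, w, hw, rfl⟩ := N.exists_add_mem_mem_orthogonal x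
      refine ⟨⟨w, hw⟩, ?_⟩
      have hy : A y = 0 := hy
      simp [B, hy]
  have hker : LinearMap.ker B.toLinearMap = ⊥ := by
    rw [LinearMap.ker_eq_bot']
    intro x hx
    have hxN : (x : H) ∈ N := hx
    exact Subtype.ext (by simpa using N.inf_orthogonal_eq_bot.le ⟨hxN, x.2⟩)
  obtain ⟨G, hG⟩ := Submodule.exists_isCompl (LinearMap.range A.toLinearMap)
  have : FiniteDimensional ℂ G :=
    (Submodule.quotientEquivOfIsCompl _ _ hG).finiteDimensional
  rw [← hrange] at hG ⊢
  exact B.closed_complemented_range_of_isCompl_of_ker_eq_bot G hG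
    G.closed_of_finiteDimensional hker

/-- One direction of the closed range theorem: the adjoint of an operator with closed range has
closed range. -/
theorem isClosed_range_adjoint [NormedAddCommGroup K] [InnerProductSpace ℂ K]
    [CompleteSpace K] (A : H →L[ℂ] K) (hA : IsClosed (LinearMap.range A.toLinearMap : Set K)) :
    IsClosed (LinearMap.range (adjoint A).toLinearMap : Set H) := by
  set R := LinearMap.range A.toLinearMap
  have : CompleteSpace R := hA.completeSpace_coe
  let B : H →L[ℂ] R := A.codRestrict R fun x => ⟨x, rfl⟩
  have hB : Function.Surjective B := by
    rintro ⟨_, x, rfl⟩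
    exact ⟨x, rfl⟩
  have hadj : adjoint A = adjoint B ∘L adjoint R.subtypeL := by
    rw [← adjoint_comp]
    rfl
  have hrange :
      LinearMap.range (adjoint A).toLinearMap = LinearMap.range (adjoint B).toLinearMap := by
    refine le_antisymm ?_ ?_
    · rintro _ ⟨y, rfl⟩
      exact ⟨adjoint R.subtypeL y, by simp [hadj]⟩
    · rintro _ ⟨y, rfl⟩
      exact ⟨y, by simp [hadj, Submodule.adjoint_subtypeL]⟩
  obtain ⟨C, hC, hpre⟩ := B.exists_preimage_norm_le hB
  have hanti : AntilipschitzWith ⟨C, hC.le⟩ (adjoint B) := by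
    refine (adjoint B).antilipschitz_of_bound fun z => ?_
    obtain ⟨w, hw, hwz⟩ := hpre z
    rcases eq_or_ne z 0 with rfl | hz
    · simp
    have hz : 0 < ‖z‖ := norm_pos_iff.2 hz
    have h₁ : ‖z‖ * ‖z‖ ≤ ‖adjoint B z‖ * ‖w‖ := by
      rw [← inner_self_eq_norm_mul_norm (𝕜 := ℂ) z]
      nth_rw 2 [← hw]
      rw [← adjoint_inner_left]
      exact re_inner_le_norm _ _
    have h₂ : ‖adjoint B z‖ * ‖w‖ ≤ ‖adjoint B z‖ * (C * ‖z‖) := by gcongr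
    refine le_of_mul_le_mul_right ?_ hz
    calc ‖z‖ * ‖z‖ ≤ ‖adjoint B z‖ * (C * ‖z‖) := h₁.trans h₂
      _ = C * ‖adjoint B z‖ * ‖z‖ := by ring
  rw [hrange]
  exact hanti.isClosed_range (adjoint B).uniformContinuous

theorem isClosed_range_adjoint_iff [NormedAddCommGroup K] [InnerProductSpace ℂ K]
    [CompleteSpace K] (A : H →L[ℂ] K) :
    IsClosed (LinearMap.range (adjoint A).toLinearMap : Set H) ↔
      IsClosed (LinearMap.range A.toLinearMap : Set K) :=
  ⟨fun h => by simpa using isClosed_range_adjoint (adjoint A) h, isClosed_range_adjoint A⟩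

end HilbertSpace

section Pair

variable {H K : Type*} [NormedAddCommGroup H] [InnerProductSpace ℂ H] [CompleteSpace H]
  [NormedAddCommGroup K] [InnerProductSpace ℂ K] [CompleteSpace K]
  {S : H →L[ℂ] K} {T : K →L[ℂ] H}

theorem adjoint_apply_eq_zero_of_apply_adjoint_eq_zero {y : H} (h : T (adjoint T y) = 0) :
    adjoint T y = 0 := by
  rw [← inner_self_eq_zero (𝕜 := ℂ), adjoint_inner_left, h, inner_zero_right]

theorem ker_add_adjoint (hTS : T ∘L S = 0) :
    LinearMap.ker (S + adjoint T).toLinearMap =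
      (LinearMap.range T.toLinearMap)ᗮ ⊓ LinearMap.ker S.toLinearMap := by
  rw [T.orthogonal_range]
  ext x
  refine ⟨fun hx => ?_, fun ⟨h₁, h₂⟩ => ?_⟩
  · have hx : S x + adjoint T x = 0 := hx
    have hT : adjoint T x = 0 := by
      apply adjoint_apply_eq_zero_of_apply_adjoint_eq_zero
      have := congrArg T hx
      rwa [map_add, map_zero, show T (S x) = 0 from DFunLike.congr_fun hTS x, zero_add] at this
    exact ⟨hT, by simpa [hT] using hx⟩
  · have h₁ : adjoint T x = 0 := h₁
    have h₂ : S x = 0 := h₂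
    simp [h₁, h₂]

theorem range_le_range_add_adjoint (hST : S ∘L T = 0) :
    LinearMap.range S.toLinearMap ≤ LinearMap.range (S + adjoint T).toLinearMap := by
  have : CompleteSpace (LinearMap.ker S.toLinearMap) := S.isClosed_ker.completeSpace_coe
  rintro _ ⟨x, rfl⟩
  obtain ⟨y, hy, w, hw, rfl⟩ :=
    (LinearMap.ker S.toLinearMap).exists_add_mem_mem_orthogonal x
  have hw : adjoint T w = 0 := by
    have := Submodule.orthogonal_le (range_le_ker_of_comp_eq_zero hST) hw
    rwa [T.orthogonal_range] at this
  have hy : S y = 0 := hy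
  exact ⟨w, by simp [hw, hy]⟩

theorem ker_inf_range_add_adjoint (hTS : T ∘L S = 0) (hST : S ∘L T = 0) :
    LinearMap.ker T.toLinearMap ⊓ LinearMap.range (S + adjoint T).toLinearMap =
      LinearMap.range S.toLinearMap := by
  have hTSx : ∀ x, T (S x) = 0 := fun x => DFunLike.congr_fun hTS x
  refine le_antisymm ?_ (le_inf ?_ (range_le_range_add_adjoint hST))
  · rintro _ ⟨hx, x, rfl⟩
    have hx : T (S x + adjoint T x) = 0 := hx
    rw [map_add, hTSx, zero_add] at hx
    exact ⟨x, by simp [adjoint_apply_eq_zero_of_apply_adjoint_eq_zero hx]⟩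
  · exact range_le_ker_of_comp_eq_zero hTS

theorem range_adjoint_le_range_add_adjoint (hST : S ∘L T = 0) :
    LinearMap.range (adjoint T).toLinearMap ≤ LinearMap.range (S + adjoint T).toLinearMap := by
  have hST' : adjoint T ∘L adjoint S = 0 := by rw [← adjoint_comp, hST, map_zero]
  have := range_le_range_add_adjoint hST'
  rwa [adjoint_adjoint, add_comm] at this

theorem ker_adjoint_inf_range_add_adjoint (hTS : T ∘L S = 0) (hST : S ∘L T = 0) :
    LinearMap.ker (adjoint S).toLinearMap ⊓ LinearMap.range (S + adjoint T).toLinearMap =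
      LinearMap.range (adjoint T).toLinearMap := by
  have hST' : adjoint T ∘L adjoint S = 0 := by rw [← adjoint_comp, hST, map_zero]
  have hTS' : adjoint S ∘L adjoint T = 0 := by rw [← adjoint_comp, hTS, map_zero]
  have := ker_inf_range_add_adjoint hTS' hST'
  rwa [adjoint_adjoint, add_comm] at this

theorem nonempty_relQuot_equiv_ker_add_adjoint (hTS : T ∘L S = 0) (hST : S ∘L T = 0)
    (hT : IsClosed (LinearMap.range T.toLinearMap : Set H)) :
    Nonempty (relQuot (LinearMap.ker S.toLinearMap) (LinearMap.range T.toLinearMap) ≃ₗ[ℂ]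
      LinearMap.ker (S + adjoint T).toLinearMap) := by
  have : CompleteSpace (LinearMap.range T.toLinearMap) := hT.completeSpace_coe
  rw [ker_add_adjoint hTS]
  exact nonempty_relQuot_equiv_of_sup_eq
    (Submodule.sup_orthogonal_inf_of_hasOrthogonalProjection (range_le_ker_of_comp_eq_zero hST))
    ((Submodule.orthogonal_disjoint _).mono_right inf_le_left)

theorem nonempty_relQuot_equiv_quotient_range_add_adjoint (hTS : T ∘L S = 0) (hST : S ∘L T = 0)
    (hT : IsClosed (LinearMap.range T.toLinearMap : Set H)) :
    Nonempty (relQuot (LinearMap.ker T.toLinearMap) (LinearMap.range S.toLinearMap) ≃ₗ[ℂ]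
      K ⧸ LinearMap.range (S + adjoint T).toLinearMap) := by
  have : CompleteSpace (LinearMap.ker T.toLinearMap) := T.isClosed_ker.completeSpace_coe
  refine nonempty_relQuot_equiv_quotient ?_ ?_
  · rw [ker_inf_range_add_adjoint hTS hST]
    exact inf_eq_right.2 (range_le_ker_of_comp_eq_zero hTS)
  · rw [eq_top_iff, ← Submodule.sup_orthogonal_of_hasOrthogonalProjection
      (K := LinearMap.ker T.toLinearMap), T.orthogonal_ker,
      (isClosed_range_adjoint T hT).submodule_topologicalClosure_eq]
    exact sup_le_sup_left (range_adjoint_le_range_add_adjoint hST) _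

theorem isClosed_range_of_finiteDimensional_relQuot (hST : S ∘L T = 0)
    [FiniteDimensional ℂ (relQuot (LinearMap.ker S.toLinearMap) (LinearMap.range T.toLinearMap))] :
    IsClosed (LinearMap.range T.toLinearMap : Set H) := by
  have hle := range_le_ker_of_comp_eq_zero hST
  have : CompleteSpace (LinearMap.ker S.toLinearMap) := S.isClosed_ker.completeSpace_coe
  let B : K →L[ℂ] LinearMap.ker S.toLinearMap := T.codRestrict _ fun x => hle ⟨x, rfl⟩
  have hB : LinearMap.range B.toLinearMap =
      (LinearMap.ker S.toLinearMap ⊓ LinearMap.range T.toLinearMap).comap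
        (LinearMap.ker S.toLinearMap).subtype := by
    rw [inf_eq_right.2 hle]
    ext x
    exact ⟨fun ⟨y, hy⟩ => ⟨y, congrArg Subtype.val hy⟩, fun ⟨y, hy⟩ => ⟨y, Subtype.ext hy⟩⟩
  have : FiniteDimensional ℂ (LinearMap.ker S.toLinearMap ⧸ LinearMap.range B.toLinearMap) := by
    rw [hB]
    infer_instance
  have himage : (LinearMap.range T.toLinearMap : Set H) =
      Subtype.val '' (LinearMap.range B.toLinearMap : Set (LinearMap.ker S.toLinearMap)) := by
    ext x
    refine ⟨?_, ?_⟩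
    · rintro ⟨y, rfl⟩
      exact ⟨B y, ⟨y, rfl⟩, rfl⟩
    · rintro ⟨_, ⟨y, rfl⟩, rfl⟩
      exact ⟨y, rfl⟩
  rw [himage]
  exact S.isClosed_ker.isClosedEmbedding_subtypeVal.isClosedMap _
    (isClosed_range_of_finiteDimensional_quotient B)

theorem isFredholmOp_add_adjoint_iff (hTS : T ∘L S = 0) (hST : S ∘L T = 0) :
    IsFredholmOp (S + adjoint T) ↔
      FiniteDimensional ℂ
          (relQuot (LinearMap.ker S.toLinearMap) (LinearMap.range T.toLinearMap)) ∧
        FiniteDimensional ℂ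
          (relQuot (LinearMap.ker T.toLinearMap) (LinearMap.range S.toLinearMap)) := by
  refine ⟨fun ⟨hker, hclosed, hcoker⟩ => ?_, fun ⟨h₁, h₂⟩ => ?_⟩
  · have hT : IsClosed (LinearMap.range T.toLinearMap : Set H) := by
      rw [← isClosed_range_adjoint_iff, ← ker_adjoint_inf_range_add_adjoint hTS hST]
      exact (adjoint S).isClosed_ker.inter hclosed
    obtain ⟨e₁⟩ := nonempty_relQuot_equiv_ker_add_adjoint hTS hST hT
    obtain ⟨e₂⟩ := nonempty_relQuot_equiv_quotient_range_add_adjoint hTS hST hT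
    exact ⟨e₁.symm.finiteDimensional, e₂.symm.finiteDimensional⟩
  · have hT := isClosed_range_of_finiteDimensional_relQuot hST
    obtain ⟨e₁⟩ := nonempty_relQuot_equiv_ker_add_adjoint hTS hST hT
    obtain ⟨e₂⟩ := nonempty_relQuot_equiv_quotient_range_add_adjoint hTS hST hT
    have := e₂.finiteDimensional
    exact ⟨e₁.finiteDimensional, isClosed_range_of_finiteDimensional_quotient _, this⟩

theorem pairIndex_eq_opIndex_add_adjoint (hTS : T ∘L S = 0) (hST : S ∘L T = 0)
    (h₁ : FiniteDimensional ℂ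
      (relQuot (LinearMap.ker S.toLinearMap) (LinearMap.range T.toLinearMap))) :
    pairIndex S T = opIndex (S + adjoint T) := by
  have hT := isClosed_range_of_finiteDimensional_relQuot hST
  obtain ⟨e₁⟩ := nonempty_relQuot_equiv_ker_add_adjoint hTS hST hT
  obtain ⟨e₂⟩ := nonempty_relQuot_equiv_quotient_range_add_adjoint hTS hST hT
  rw [pairIndex, opIndex, (finite_relQuot_of_le (range_le_ker_of_comp_eq_zero hST)).2,
    (finite_relQuot_of_le (range_le_ker_of_comp_eq_zero hTS)).2, e₁.finrank_eq, e₂.finrank_eq]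
  simp

end Pair

variable {H₁ H₂ : Type*} [NormedAddCommGroup H₁] [InnerProductSpace ℂ H₁] [CompleteSpace H₁]
  [NormedAddCommGroup H₂] [InnerProductSpace ℂ H₂] [CompleteSpace H₂]

theorem fredholm_pair_exact_tfae (S : H₁ →L[ℂ] H₂) (T : H₂ →L[ℂ] H₁)
    (hTS : T ∘L S = 0) (hST : S ∘L T = 0) :
    ([FiniteDimensional ℂ (relQuot (LinearMap.ker S.toLinearMap) (LinearMap.range T.toLinearMap)) ∧
        FiniteDimensional ℂ (relQuot (LinearMap.ker T.toLinearMap) (LinearMap.range S.toLinearMap)),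
      IsFredholmOp (S + adjoint T),
      IsFredholmOp (T + adjoint S)].TFAE) ∧
    (FiniteDimensional ℂ (relQuot (LinearMap.ker S.toLinearMap) (LinearMap.range T.toLinearMap)) →
      FiniteDimensional ℂ (relQuot (LinearMap.ker T.toLinearMap) (LinearMap.range S.toLinearMap)) →
      IsFredholmPair S T ∧ pairIndex S T = opIndex (S + adjoint T) ∧
        opIndex (S + adjoint T) = - opIndex (T + adjoint S)) := by
  refine ⟨?_, fun h₁ h₂ => ⟨isFredholmPair_of_finiteDimensional hTS hST h₁ h₂,
    pairIndex_eq_opIndex_add_adjoint hTS hST h₁, ?_⟩⟩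
  · tfae_have 2 ↔ 1 := isFredholmOp_add_adjoint_iff hTS hST
    tfae_have 3 ↔ 1 := (isFredholmOp_add_adjoint_iff hST hTS).trans and_comm
    tfae_finish
  · rw [← pairIndex_eq_opIndex_add_adjoint hTS hST h₁,
      ← pairIndex_eq_opIndex_add_adjoint hST hTS h₂, pairIndex_swap S T, neg_neg]
end
end

section
/- Let H₁ and H₂ be Hilbert spaces, S ∈ L(H₁,H₂) and T ∈ L(H₂,H₁). Then (S,T) is a Fredholm pair if and only if (T*, S*) is a Fredholm pair (with T* ∈ L(H₁,H₂) and S* ∈ L(H₂,H₁)). Furthermore, in this case ind(T*,S*) = ind(S,T). -/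
open Module ContinuousLinearMap

noncomputable section

set_option maxHeartbeats 1000000
set_option synthInstance.maxHeartbeats 1000000

/-- If `p / (p ⊓ q)` is finite dimensional, then `p` is contained in the sum of `q` and the span of
`dim p / (p ⊓ q)` many vectors of `p`. -/
theorem exists_le_sup_span_of_finiteDimensional_relQuot {E : Type*} [AddCommGroup E] [Module ℂ E]
    (p q : Submodule ℂ E) [FiniteDimensional ℂ (relQuot p q)] :
    ∃ v : Fin (finrank ℂ (relQuot p q)) → E,
      (∀ i, v i ∈ p) ∧ p ≤ q ⊔ Submodule.span ℂ (Set.range v) := by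
  let b := Module.finBasis ℂ (relQuot p q)
  choose w hw using fun i => Submodule.mkQ_surjective ((p ⊓ q).comap p.subtype) (b i)
  refine ⟨fun i => w i, fun i => (w i).2, fun a ha => ?_⟩
  let c := b.repr (Submodule.mkQ _ (⟨a, ha⟩ : p))
  have h : (⟨a, ha⟩ : p) - ∑ i, c i • w i ∈ (p ⊓ q).comap p.subtype := by
    refine (Submodule.Quotient.mk_eq_zero _).1 ?_
    rw [← Submodule.mkQ_apply, map_sub, map_sum, sub_eq_zero]
    simp_rw [map_smul, hw]
    exact (b.sum_repr _).symm
  have hq : a - ∑ i, c i • (w i : E) ∈ q := by simpa using h.2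
  rw [← sub_add_cancel a (∑ i, c i • (w i : E))]
  exact Submodule.add_mem_sup hq
    (Submodule.sum_mem _ fun i _ => Submodule.smul_mem _ _ (Submodule.subset_span ⟨i, rfl⟩))

/-- Passing to orthogonal complements does not increase the relative dimension. -/
theorem finrank_relQuot_orthogonal_le {E : Type*} [NormedAddCommGroup E] [InnerProductSpace ℂ E]
    (p q : Submodule ℂ E) [FiniteDimensional ℂ (relQuot p q)] :
    FiniteDimensional ℂ (relQuot qᗮ pᗮ) ∧
      finrank ℂ (relQuot qᗮ pᗮ) ≤ finrank ℂ (relQuot p q) := by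
  obtain ⟨v, hv, hp⟩ := exists_le_sup_span_of_finiteDimensional_relQuot p q
  let φ : qᗮ →ₗ[ℂ] (Fin (finrank ℂ (relQuot p q)) → ℂ) :=
    LinearMap.pi fun i => (innerSL ℂ (v i)).toLinearMap ∘ₗ qᗮ.subtype
  have hker : LinearMap.ker φ = (qᗮ ⊓ pᗮ).comap qᗮ.subtype := by
    ext x
    rw [LinearMap.mem_ker, Submodule.mem_comap]
    refine ⟨fun h => ⟨x.2, ?_⟩, fun h => funext fun i => h.2 _ (hv i)⟩
    refine Submodule.orthogonal_le hp ?_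
    rw [← Submodule.inf_orthogonal]
    refine ⟨x.2, (Submodule.mem_orthogonal _ _).2 fun u hu => ?_⟩
    induction hu using Submodule.span_induction with
    | mem u hu =>
      obtain ⟨i, rfl⟩ := hu
      exact congrFun h i
    | zero => exact inner_zero_left _
    | add a b _ _ ha hb => rw [inner_add_left, ha, hb, add_zero]
    | smul c a _ ha => rw [inner_smul_left, ha, mul_zero]
  let ψ : relQuot qᗮ pᗮ →ₗ[ℂ] (Fin (finrank ℂ (relQuot p q)) → ℂ) :=
    Submodule.liftQ _ φ hker.ge
  have hψ : Function.Injective ψ :=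
    LinearMap.ker_eq_bot.1 (Submodule.ker_liftQ_eq_bot _ _ _ hker.le)
  refine ⟨FiniteDimensional.of_injective ψ hψ, ?_⟩
  simpa using LinearMap.finrank_le_finrank_of_injective hψ

/-- For closed subspaces, orthogonal complements preserve the relative dimension. -/
theorem finrank_relQuot_orthogonal {E : Type*} [NormedAddCommGroup E] [InnerProductSpace ℂ E]
    [CompleteSpace E] {p q : Submodule ℂ E} (hp : IsClosed (p : Set E)) (hq : IsClosed (q : Set E))
    [FiniteDimensional ℂ (relQuot p q)] :
    finrank ℂ (relQuot qᗮ pᗮ) = finrank ℂ (relQuot p q) := by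
  have : CompleteSpace p := hp.completeSpace_coe
  have : CompleteSpace q := hq.completeSpace_coe
  obtain ⟨hfin, hle⟩ := finrank_relQuot_orthogonal_le p q
  have hge := (finrank_relQuot_orthogonal_le qᗮ pᗮ).2
  rw [p.orthogonal_orthogonal, q.orthogonal_orthogonal] at hge
  exact le_antisymm hle hge

/-- If the range of an injective bounded operator becomes closed after adding a finite dimensional
subspace, then it is closed. -/
theorem isClosed_range_of_isClosed_range_sup {E F : Type*} [NormedAddCommGroup E] [NormedSpace ℂ E]
    [CompleteSpace E] [NormedAddCommGroup F] [NormedSpace ℂ F] [CompleteSpace F]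
    (f : E →L[ℂ] F) (hf : Function.Injective f) (G : Submodule ℂ F) [FiniteDimensional ℂ G]
    (h : IsClosed ((LinearMap.range f.toLinearMap ⊔ G : Submodule ℂ F) : Set F)) :
    IsClosed (LinearMap.range f.toLinearMap : Set F) := by
  set R := LinearMap.range f.toLinearMap
  obtain ⟨C, hC⟩ := Submodule.exists_isCompl (R.comap G.subtype)
  let G' := C.map G.subtype
  have hdisj : Disjoint R G' := by
    rw [Submodule.disjoint_def]
    rintro _ hxR ⟨y, hy, rfl⟩
    have : y = 0 := (Submodule.disjoint_def.1 hC.disjoint) y hxR hy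
    simp [this]
  have hsup : R ⊔ G' = R ⊔ G := by
    refine le_antisymm (sup_le_sup_left (Submodule.map_subtype_le _ _) _) (sup_le le_sup_left ?_)
    have hG : G = (R.comap G.subtype ⊔ C).map G.subtype := by
      rw [hC.sup_eq_top, Submodule.map_subtype_top]
    rw [hG, Submodule.map_sup]
    exact sup_le_sup_right (Submodule.map_comap_le _ _) _
  have : CompleteSpace G' := FiniteDimensional.complete ℂ G'
  let g : E × G' →L[ℂ] F := f.coprod G'.subtypeL
  have hginj : Function.Injective g := by
    rw [injective_iff_map_eq_zero]
    rintro ⟨x, y⟩ hxy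
    have hxy : f x + y = 0 := by simpa [g] using hxy
    have hfx : f x = 0 := Submodule.disjoint_def.1 hdisj _ ⟨x, rfl⟩
      (by rw [eq_neg_of_add_eq_zero_left hxy]; exact G'.neg_mem y.2)
    have hx : x = 0 := (injective_iff_map_eq_zero f).1 hf _ hfx
    have hy : y = 0 := by simpa [hfx] using hxy
    rw [hx, hy, Prod.mk_zero_zero]
  have hgrange : Set.range g = ((R ⊔ G : Submodule ℂ F) : Set F) := by
    rw [← hsup]
    ext z
    simp [g, R, Submodule.mem_sup]
  obtain ⟨K, hK⟩ := g.antilipschitz_of_injective_of_isClosed_range hginj (hgrange ▸ h)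
  refine (f.isClosed_range_iff_antilipschitz_of_injective hf).2 ⟨K, fun x y => ?_⟩
  simpa [g, Prod.edist_eq] using hK (x, 0) (y, 0)

section Hilbert

variable {E F : Type*} [NormedAddCommGroup E] [InnerProductSpace ℂ E]
  [NormedAddCommGroup F] [InnerProductSpace ℂ F]

theorem injective_comp_subtypeL_orthogonal_ker (A : E →L[ℂ] F) :
    Function.Injective (A ∘L (LinearMap.ker A.toLinearMap)ᗮ.subtypeL) := by
  rw [injective_iff_map_eq_zero]
  intro x hx
  exact Subtype.ext (Submodule.disjoint_def.1
    (LinearMap.ker A.toLinearMap).orthogonal_disjoint x hx x.2)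

variable [CompleteSpace E]

theorem range_comp_subtypeL_orthogonal_ker (A : E →L[ℂ] F) :
    LinearMap.range (A ∘L (LinearMap.ker A.toLinearMap)ᗮ.subtypeL).toLinearMap =
      LinearMap.range A.toLinearMap := by
  have : CompleteSpace (LinearMap.ker A.toLinearMap) := A.isClosed_ker.completeSpace_coe
  refine le_antisymm (by rintro _ ⟨x, rfl⟩; exact ⟨x, rfl⟩) ?_
  rintro _ ⟨x, rfl⟩
  obtain ⟨y, hy, z, hz, rfl⟩ := (LinearMap.ker A.toLinearMap).exists_add_mem_mem_orthogonal x
  refine ⟨⟨z, hz⟩, ?_⟩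
  have hy : A y = 0 := hy
  simp [hy]

variable [CompleteSpace F]

/-- An operator range which is commensurable with a closed subspace is closed. -/
theorem isClosed_range_of_finiteDimensional_relQuot_s10 (A : E →L[ℂ] F) {N : Submodule ℂ F}
    (hN : IsClosed (N : Set F)) [FiniteDimensional ℂ (relQuot N (LinearMap.range A.toLinearMap))]
    [FiniteDimensional ℂ (relQuot (LinearMap.range A.toLinearMap) N)] :
    IsClosed (LinearMap.range A.toLinearMap : Set F) := by
  set R := LinearMap.range A.toLinearMap
  obtain ⟨v, hv, hNv⟩ := exists_le_sup_span_of_finiteDimensional_relQuot N R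
  obtain ⟨w, hw, hRw⟩ := exists_le_sup_span_of_finiteDimensional_relQuot R N
  have hvN : Submodule.span ℂ (Set.range v) ≤ N := Submodule.span_le.2 (Set.range_subset_iff.2 hv)
  have hwR : Submodule.span ℂ (Set.range w) ≤ R := Submodule.span_le.2 (Set.range_subset_iff.2 hw)
  have hfv := FiniteDimensional.span_of_finite ℂ (Set.finite_range v)
  have hfw := FiniteDimensional.span_of_finite ℂ (Set.finite_range w)
  have hsup : R ⊔ Submodule.span ℂ (Set.range v) = N ⊔ Submodule.span ℂ (Set.range w) :=
    le_antisymm (sup_le hRw (hvN.trans le_sup_left)) (sup_le hNv (hwR.trans le_sup_left))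
  have hcl := N.isClosed_sup_finiteDimensional (Submodule.span ℂ (Set.range w)) hN
  rw [← hsup] at hcl
  have hrange : LinearMap.range (A ∘L (LinearMap.ker A.toLinearMap)ᗮ.subtypeL).toLinearMap = R :=
    range_comp_subtypeL_orthogonal_ker A
  have hclosed := isClosed_range_of_isClosed_range_sup _
    (injective_comp_subtypeL_orthogonal_ker A) (Submodule.span ℂ (Set.range v))
    (by rwa [hrange])
  rwa [hrange] at hclosed

/-- The closed range theorem: if `A` has closed range, then `R(A*) = N(A)ᗮ`. -/
theorem range_adjoint_eq_orthogonal_ker (A : E →L[ℂ] F)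
    (hA : IsClosed (LinearMap.range A.toLinearMap : Set F)) :
    LinearMap.range (adjoint A).toLinearMap = (LinearMap.ker A.toLinearMap)ᗮ := by
  refine le_antisymm ?_ fun x hx => ?_
  · rw [A.orthogonal_ker]
    exact Submodule.le_topologicalClosure _
  let g := A ∘L (LinearMap.ker A.toLinearMap)ᗮ.subtypeL
  have hrange : LinearMap.range g.toLinearMap = LinearMap.range A.toLinearMap :=
    range_comp_subtypeL_orthogonal_ker A
  have hcl : IsClosed (LinearMap.range g.toLinearMap : Set F) := hrange ▸ hA
  have hcomp : CompleteSpace (LinearMap.range g.toLinearMap) := hcl.completeSpace_coe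
  let e := g.equivRange (injective_comp_subtypeL_orthogonal_ker A) hcl
  let B : F →L[ℂ] E := (LinearMap.ker A.toLinearMap)ᗮ.subtypeL ∘L
    (e.symm : LinearMap.range g.toLinearMap →L[ℂ] _) ∘L
      (LinearMap.range g.toLinearMap).orthogonalProjectionOnto
  have hB : ∀ y, A (B (A y)) = A y := by
    intro y
    have hy : A y ∈ LinearMap.range g.toLinearMap := hrange ▸ ⟨y, rfl⟩
    have hproj : (LinearMap.range g.toLinearMap).orthogonalProjectionOnto (A y) = ⟨A y, hy⟩ :=
      Submodule.orthogonalProjectionOnto_mem_subspace_eq_self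
        (⟨A y, hy⟩ : LinearMap.range g.toLinearMap)
    calc A (B (A y)) = g (e.symm ⟨A y, hy⟩) := by rw [← hproj]; rfl
      _ = A y := congrArg Subtype.val (e.apply_symm_apply ⟨A y, hy⟩)
  refine ⟨adjoint B x, ext_inner_left ℂ fun y => ?_⟩
  have hker : y - B (A y) ∈ LinearMap.ker A.toLinearMap := by
    simp [hB]
  have := hx _ hker
  rw [inner_sub_left, sub_eq_zero] at this
  simp [adjoint_inner_right, this]

/-- The operators of a Fredholm pair have closed range. -/
theorem IsFredholmPair.isClosed_range {S : E →L[ℂ] F} {T : F →L[ℂ] E}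
    (h : IsFredholmPair S T) :
    IsClosed (LinearMap.range S.toLinearMap : Set F) ∧
      IsClosed (LinearMap.range T.toLinearMap : Set E) := by
  obtain ⟨h₁, h₂, h₃, h₄⟩ := h
  exact ⟨isClosed_range_of_finiteDimensional_relQuot_s10 S T.isClosed_ker,
    isClosed_range_of_finiteDimensional_relQuot_s10 T S.isClosed_ker⟩

theorem IsFredholmPair.adjoint_pair {S : E →L[ℂ] F} {T : F →L[ℂ] E} (h : IsFredholmPair S T) :
    IsFredholmPair (adjoint T) (adjoint S) := by
  obtain ⟨hS, hT⟩ := h.isClosed_range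
  obtain ⟨h₁, h₂, h₃, h₄⟩ := h
  rw [IsFredholmPair, range_adjoint_eq_orthogonal_ker S hS, range_adjoint_eq_orthogonal_ker T hT,
    ← S.orthogonal_range, ← T.orthogonal_range]
  exact ⟨(finrank_relQuot_orthogonal_le _ _).1, (finrank_relQuot_orthogonal_le _ _).1,
    (finrank_relQuot_orthogonal_le _ _).1, (finrank_relQuot_orthogonal_le _ _).1⟩

theorem IsFredholmPair.pairIndex_adjoint {S : E →L[ℂ] F} {T : F →L[ℂ] E} (h : IsFredholmPair S T) :
    pairIndex (adjoint T) (adjoint S) = pairIndex S T := by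
  obtain ⟨hS, hT⟩ := h.isClosed_range
  obtain ⟨h₁, h₂, h₃, h₄⟩ := h
  rw [pairIndex, range_adjoint_eq_orthogonal_ker S hS, range_adjoint_eq_orthogonal_ker T hT,
    ← S.orthogonal_range, ← T.orthogonal_range,
    finrank_relQuot_orthogonal S.isClosed_ker hT, finrank_relQuot_orthogonal hT S.isClosed_ker,
    finrank_relQuot_orthogonal T.isClosed_ker hS, finrank_relQuot_orthogonal hS T.isClosed_ker,
    pairIndex]

end Hilbert

variable {H₁ H₂ : Type*} [NormedAddCommGroup H₁] [InnerProductSpace ℂ H₁] [CompleteSpace H₁]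
  [NormedAddCommGroup H₂] [InnerProductSpace ℂ H₂] [CompleteSpace H₂]

theorem fredholm_pair_adjoint (S : H₁ →L[ℂ] H₂) (T : H₂ →L[ℂ] H₁) :
    (IsFredholmPair S T ↔ IsFredholmPair (adjoint T) (adjoint S)) ∧
    (IsFredholmPair S T → pairIndex (adjoint T) (adjoint S) = pairIndex S T) := by
  refine ⟨⟨fun h => h.adjoint_pair, fun h => ?_⟩, fun h => h.pairIndex_adjoint⟩
  simpa only [adjoint_adjoint] using h.adjoint_pair
end
end
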